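/- Let u ∈ ℤ_{≥0}^j and suppose G ⊆ K_{j+1}^+ ∪ K_{j+1}^- satisfies: (i) every (z, z') ∈ K_{j+1}^+ ∪ K_{j+1}^- with z ≤ u (componentwise) is a finite nonnegative-integer combination of elements of G; and (ii) for all (v, v'), (w, w') ∈ G with v'·w' < 0 and v + w ≤ u, the sum (v + w, v' + w') is a finite nonnegative-integer combination of elements of G each of which is ⊑_{j+1} (v + w, v' + w'). Then G contains every irreducible element (z, z') of K_{j+1}^+ ∪ K_{j+1}^- with z ≤ u; i.e., the completion procedure using only S-vectors truncated by the upper bounds u computes all elements of H_{j+1}^+ ∪ H_{j+1}^- lying below u. -/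

import Mathlib

/-- Projection of a vector onto its first `j` coordinates. -/
def proj {α : Type*} (n j : ℕ) (h : j ≤ n) (v : Fin n → α) : Fin j → α :=
  fun i => v (Fin.castLE h i)

/-- Projection onto the first `j + 1` coordinates, presented as a pair
    (first `j` coordinates, `(j+1)`-st coordinate). -/
def projPair {α : Type*} (n j : ℕ) (h : j + 1 ≤ n) (v : Fin n → α) : (Fin j → α) × α :=
  (fun i => v (Fin.castLE h i.castSucc), v ⟨j, h⟩)

/-- The lattice `Λ ⊆ ℤ^n` generated by the vectors `p_1, …, p_s`. -/
def latticeOf {n s : ℕ} (p : Fin s → Fin n → ℤ) : AddSubgroup (Fin n → ℤ) :=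
  AddSubgroup.closure (Set.range p)

/-- `K_j := π_j(Λ)`. -/
def KProj (n s j : ℕ) (h : j ≤ n) (p : Fin s → Fin n → ℤ) : Set (Fin j → ℤ) :=
  proj n j h '' (latticeOf p : Set (Fin n → ℤ))

/-- `K_j^+`: the elements of `K_j` with all coordinates nonnegative. -/
def KProjPlus (n s j : ℕ) (h : j ≤ n) (p : Fin s → Fin n → ℤ) : Set (Fin j → ℤ) :=
  {z ∈ KProj n s j h p | ∀ i, 0 ≤ z i}

/-- `K_{j+1} := π_{j+1}(Λ)`, in pair form. -/
def KPair (n s j : ℕ) (h : j + 1 ≤ n) (p : Fin s → Fin n → ℤ) : Set ((Fin j → ℤ) × ℤ) :=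
  projPair n j h '' (latticeOf p : Set (Fin n → ℤ))

/-- `K_{j+1}^+`: first `j` coordinates nonnegative and last coordinate nonnegative. -/
def KPairPlus (n s j : ℕ) (h : j + 1 ≤ n) (p : Fin s → Fin n → ℤ) : Set ((Fin j → ℤ) × ℤ) :=
  {z ∈ KPair n s j h p | (∀ i, 0 ≤ z.1 i) ∧ 0 ≤ z.2}

/-- `K_{j+1}^-`: first `j` coordinates nonnegative and last coordinate nonpositive. -/
def KPairMinus (n s j : ℕ) (h : j + 1 ≤ n) (p : Fin s → Fin n → ℤ) : Set ((Fin j → ℤ) × ℤ) :=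
  {z ∈ KPair n s j h p | (∀ i, 0 ≤ z.1 i) ∧ z.2 ≤ 0}

/-- The partial order `u ⊑_{j+1} v`. -/
def sqle {j : ℕ} (u v : (Fin j → ℤ) × ℤ) : Prop :=
  (∀ i, u.1 i ≤ v.1 i) ∧ |u.2| ≤ |v.2| ∧ 0 ≤ u.2 * v.2

/-- `z` is a finite nonnegative-integer combination of elements of `F`. -/
def IsNNComb {α : Type*} [AddCommMonoid α] (F : Set α) (z : α) : Prop :=
  ∃ c : α →₀ ℕ, ↑c.support ⊆ F ∧ z = c.sum fun a k => k • a

/-- `z` is a finite nonnegative-integer combination of elements of `F`, all of which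
satisfy the predicate `P` (the coefficients on the support are automatically positive). -/
def IsNNCombP {α : Type*} [AddCommMonoid α] (F : Set α) (P : α → Prop) (z : α) : Prop :=
  ∃ c : α →₀ ℕ, ↑c.support ⊆ F ∧ (∀ a ∈ c.support, P a) ∧ z = c.sum fun a k => k • a

/-- `z` is an irreducible element of (the monoid) `S`: it is a nonzero element of `S`
that is not the sum of two nonzero elements of `S`. -/
def IsIrred {α : Type*} [AddCommMonoid α] (S : Set α) (z : α) : Prop :=
  z ∈ S ∧ z ≠ 0 ∧ ∀ x ∈ S, ∀ y ∈ S, x ≠ 0 → y ≠ 0 → z ≠ x + y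

theorem IsIrred.mem_of_eq_multiset_sum {α : Type*} [AddCommMonoid α] (S : AddSubmonoid α) {z : α}
    (hz : IsIrred (S : Set α) z) (m : Multiset α) (hm : ∀ a ∈ m, a ∈ S) (h : z = m.sum) :
    z ∈ m := by
  induction m using Multiset.induction with
  | empty => exact absurd (by simpa using h) hz.2.1
  | cons a m ih =>
    have hmS : ∀ b ∈ m, b ∈ S := fun b hb => hm b (Multiset.mem_cons_of_mem hb)
    rw [Multiset.sum_cons] at h
    by_cases ha : a = 0
    · exact Multiset.mem_cons_of_mem (ih hmS (by simpa [ha] using h))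
    by_cases hr : m.sum = 0
    · simp [h, hr]
    exact absurd h (hz.2.2 a (hm a (Multiset.mem_cons_self a m)) m.sum
      (AddSubmonoid.multiset_sum_mem S m hmS) ha hr)

theorem IsNNComb.exists_multiset {α : Type*} [AddCommMonoid α] {F : Set α} {z : α}
    (h : IsNNComb F z) : ∃ m : Multiset α, (∀ a ∈ m, a ∈ F) ∧ z = m.sum := by
  classical
  obtain ⟨c, hc, rfl⟩ := h
  refine ⟨Finsupp.toMultiset c, fun a ha => hc ?_, (Finsupp.sum_toMultiset c).symm⟩
  simpa using ha

theorem IsNNCombP.exists_multiset {α : Type*} [AddCommMonoid α] {F : Set α} {P : α → Prop} {z : α}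
    (h : IsNNCombP F P z) : ∃ m : Multiset α, (∀ a ∈ m, a ∈ F ∧ P a) ∧ z = m.sum := by
  obtain ⟨c, hc, hP, hz⟩ := h
  have hcomb : IsNNComb (F ∩ {a | P a}) z := ⟨c, fun a ha => ⟨hc ha, hP a ha⟩, hz⟩
  exact hcomb.exists_multiset

/-- For a multiset of pairs whose last coordinates do not change sign, the absolute values of last
coordinates add up. -/
theorem sum_natAbs_snd_eq {β : Type*} [AddCommMonoid β] (m : Multiset (β × ℤ))
    (h : (∀ a ∈ m, 0 ≤ a.2) ∨ ∀ a ∈ m, a.2 ≤ 0) :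
    (m.map fun a => a.2.natAbs).sum = m.sum.2.natAbs := by
  suffices H : ((∀ a ∈ m, 0 ≤ a.2) → 0 ≤ m.sum.2 ∧
        (((m.map fun a => a.2.natAbs).sum : ℕ) : ℤ) = m.sum.2) ∧
      ((∀ a ∈ m, a.2 ≤ 0) → m.sum.2 ≤ 0 ∧
        (((m.map fun a => a.2.natAbs).sum : ℕ) : ℤ) = -m.sum.2) by
    rcases h with h | h
    · have := H.1 h
      omega
    · have := H.2 h
      omega
  clear h
  induction m using Multiset.induction with
  | empty => simp
  | cons a m ih =>
    simp only [Multiset.mem_cons, forall_eq_or_imp, Multiset.map_cons, Multiset.sum_cons,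
      Prod.snd_add]
    constructor
    · rintro ⟨ha, hm⟩
      have := ih.1 hm
      omega
    · rintro ⟨ha, hm⟩
      have := ih.2 hm
      omega

theorem same_sign_of_sqle {j : ℕ} {m : Multiset ((Fin j → ℤ) × ℤ)} {v : (Fin j → ℤ) × ℤ}
    (h : ∀ a ∈ m, sqle a v) : (∀ a ∈ m, 0 ≤ a.2) ∨ ∀ a ∈ m, a.2 ≤ 0 := by
  rcases le_or_gt 0 v.2 with hv | hv
  · left
    intro a ha
    obtain ⟨-, h1, h2⟩ := h a ha
    by_contra! hneg
    rcases hv.eq_or_lt with h0 | h0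
    · rw [← h0, abs_zero] at h1
      exact hneg.ne (abs_nonpos_iff.1 h1)
    · exact absurd h2 (mul_neg_of_neg_of_pos hneg h0).not_ge
  · right
    intro a ha
    obtain ⟨-, -, h2⟩ := h a ha
    by_contra! hpos
    exact absurd h2 (mul_neg_of_pos_of_neg hpos hv).not_ge

/-- If S-vectors below `u` reduce to zero, every sum of elements of `G` lying below `u` can be
rewritten as a sum of elements of `G` whose last coordinates do not change sign. -/
theorem exists_same_sign_sum {j : ℕ} {u : Fin j → ℤ} {G : Set ((Fin j → ℤ) × ℤ)}
    (hG : ∀ a ∈ G, 0 ≤ a.1)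
    (hS : ∀ v ∈ G, ∀ w ∈ G, v.2 * w.2 < 0 → (∀ i, v.1 i + w.1 i ≤ u i) →
      IsNNCombP G (fun a => sqle a (v + w)) (v + w))
    (m : Multiset ((Fin j → ℤ) × ℤ)) (hm : ∀ a ∈ m, a ∈ G) (hu : m.sum.1 ≤ u) :
    ∃ m' : Multiset ((Fin j → ℤ) × ℤ), (∀ a ∈ m', a ∈ G) ∧ m'.sum = m.sum ∧
      ((∀ a ∈ m', 0 ≤ a.2) ∨ ∀ a ∈ m', a.2 ≤ 0) := by
  induction hN : (m.map fun a => a.2.natAbs).sum using Nat.strong_induction_on generalizing m with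
  | _ N ih =>
    by_cases hsign : (∀ a ∈ m, 0 ≤ a.2) ∨ ∀ a ∈ m, a.2 ≤ 0
    · exact ⟨m, hm, rfl, hsign⟩
    push Not at hsign
    obtain ⟨⟨v, hv, hv0⟩, w, hw, hw0⟩ := hsign
    obtain ⟨m₁, rfl⟩ := Multiset.exists_cons_of_mem hv
    have hw₁ : w ∈ m₁ := by
      rcases Multiset.mem_cons.1 hw with rfl | h
      · omega
      · exact h
    obtain ⟨r, rfl⟩ := Multiset.exists_cons_of_mem hw₁
    have hr : ∀ a ∈ r, a ∈ G := fun a ha => hm a (by simp [ha])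
    have hr0 : 0 ≤ r.sum.1 := by
      have hmem := AddSubmonoid.multiset_sum_mem
        ((AddSubmonoid.nonneg (Fin j → ℤ)).comap (AddMonoidHom.fst (Fin j → ℤ) ℤ)) r
        fun a ha => hG a (hr a ha)
      exact hmem
    have hvw : ∀ i, v.1 i + w.1 i ≤ u i := fun i => by
      have h1 := hu i
      have h2 := hr0 i
      simp only [Multiset.sum_cons, Prod.fst_add, Pi.add_apply, Pi.zero_apply] at h1 h2
      omega
    obtain ⟨t, ht, htsum⟩ := (hS v (hm v hv) w (hm w hw)
      (mul_neg_of_neg_of_pos hv0 hw0) hvw).exists_multiset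
    have hsum : (t + r).sum = (v ::ₘ w ::ₘ r).sum := by
      simp [← htsum, add_assoc]
    have htabs := sum_natAbs_snd_eq t (same_sign_of_sqle fun a ha => (ht a ha).2)
    rw [← htsum, Prod.snd_add] at htabs
    rw [← hsum]
    refine ih _ ?_ (t + r) (fun a ha => ?_) (hsum ▸ hu) rfl
    · simp only [Multiset.map_cons, Multiset.sum_cons] at hN
      rw [Multiset.map_add, Multiset.sum_add, htabs, ← hN]
      omega
    · rcases Multiset.mem_add.1 ha with h | h
      · exact (ht a h).1
      · exact hr a h

theorem snd_eq_zero_of_sum_snd_eq_zero {β : Type*} [AddCommMonoid β] {m : Multiset (β × ℤ)}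
    (h : (∀ a ∈ m, 0 ≤ a.2) ∨ ∀ a ∈ m, a.2 ≤ 0) (h0 : m.sum.2 = 0) : ∀ a ∈ m, a.2 = 0 := by
  intro a ha
  have hle := Multiset.single_le_sum (fun _ _ => Nat.zero_le _) _
    (Multiset.mem_map_of_mem (fun a : β × ℤ => a.2.natAbs) ha)
  rw [sum_natAbs_snd_eq m h, h0] at hle
  simpa using hle

theorem snd_sign_of_sum_snd_sign {β : Type*} [AddCommMonoid β] {m : Multiset (β × ℤ)}
    (h : (∀ a ∈ m, 0 ≤ a.2) ∨ ∀ a ∈ m, a.2 ≤ 0) :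
    (0 ≤ m.sum.2 → ∀ a ∈ m, 0 ≤ a.2) ∧ (m.sum.2 ≤ 0 → ∀ a ∈ m, a.2 ≤ 0) := by
  have key : ∀ S : AddSubmonoid ℤ, (∀ a ∈ m, a.2 ∈ S) → m.sum.2 ∈ S := fun S hS =>
    AddSubmonoid.multiset_sum_mem (S.comap (AddMonoidHom.snd β ℤ)) m hS
  constructor
  · intro hs
    rcases h with hp | hn
    · exact hp
    · have hs' : 0 ≤ -m.sum.2 := key ((AddSubmonoid.nonneg ℤ).comap (-AddMonoidHom.id ℤ))
        fun a ha => neg_nonneg.2 (hn a ha)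
      exact fun a ha => (snd_eq_zero_of_sum_snd_eq_zero (.inr hn) (by omega) a ha).ge
  · intro hs
    rcases h with hp | hn
    · have hs' : 0 ≤ m.sum.2 := key (AddSubmonoid.nonneg ℤ) hp
      exact fun a ha => (snd_eq_zero_of_sum_snd_eq_zero (.inl hp) (by omega) a ha).le
    · exact hn

theorem zero_mem_KPair (n s j : ℕ) (h : j + 1 ≤ n) (p : Fin s → Fin n → ℤ) :
    0 ∈ KPair n s j h p :=
  ⟨0, zero_mem (latticeOf p), rfl⟩

theorem add_mem_KPair {n s j : ℕ} {h : j + 1 ≤ n} {p : Fin s → Fin n → ℤ} {x y : (Fin j → ℤ) × ℤ}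
    (hx : x ∈ KPair n s j h p) (hy : y ∈ KPair n s j h p) : x + y ∈ KPair n s j h p := by
  obtain ⟨a, ha, rfl⟩ := hx
  obtain ⟨b, hb, rfl⟩ := hy
  exact ⟨a + b, add_mem (S := AddSubgroup (Fin n → ℤ)) ha hb, rfl⟩

/-- `K_{j+1}^+` as a submonoid. -/
def KPairPlusSubmonoid (n s j : ℕ) (h : j + 1 ≤ n) (p : Fin s → Fin n → ℤ) :
    AddSubmonoid ((Fin j → ℤ) × ℤ) where
  carrier := KPairPlus n s j h p
  zero_mem' := ⟨zero_mem_KPair n s j h p, fun _ => le_rfl, le_rfl⟩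
  add_mem' hx hy := ⟨add_mem_KPair hx.1 hy.1, fun i => add_nonneg (hx.2.1 i) (hy.2.1 i),
    add_nonneg hx.2.2 hy.2.2⟩

/-- `K_{j+1}^-` as a submonoid. -/
def KPairMinusSubmonoid (n s j : ℕ) (h : j + 1 ≤ n) (p : Fin s → Fin n → ℤ) :
    AddSubmonoid ((Fin j → ℤ) × ℤ) where
  carrier := KPairMinus n s j h p
  zero_mem' := ⟨zero_mem_KPair n s j h p, fun _ => le_rfl, le_rfl⟩
  add_mem' hx hy := ⟨add_mem_KPair hx.1 hy.1, fun i => add_nonneg (hx.2.1 i) (hy.2.1 i),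
    add_nonpos hx.2.2 hy.2.2⟩

/-- Truncated completion: let `u ∈ ℤ_{≥0}^j`. If every element of `K_{j+1}^+ ∪ K_{j+1}^-` lying
below `u` is a nonnegative-integer combination of elements of `G`, and every S-vector of two
elements of `G` staying below `u` reduces to `0` with respect to `G` (i.e. is a
nonnegative-integer combination of elements of `G` that are `⊑_{j+1}` it), then `G` contains
every irreducible element of `K_{j+1}^+ ∪ K_{j+1}^-` lying below `u`. -/
theorem stmt9 (n s j : ℕ) (hs : 1 ≤ s) (hsn : s ≤ n) (hj : 1 ≤ j) (hjn : j + 1 ≤ n)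
    (p : Fin s → Fin n → ℤ)
    (hech1 : ∀ (i : Fin s) (k : Fin n), (k : ℕ) < (i : ℕ) → p i k = 0)
    (hech2 : ∀ i : Fin s, 0 < p i ⟨(i : ℕ), lt_of_lt_of_le i.isLt hsn⟩)
    (u : Fin j → ℤ) (hu : ∀ i, 0 ≤ u i)
    (G : Set ((Fin j → ℤ) × ℤ))
    (hGsub : G ⊆ KPairPlus n s j hjn p ∪ KPairMinus n s j hjn p)
    (hGgen : ∀ z ∈ KPairPlus n s j hjn p ∪ KPairMinus n s j hjn p,
      (∀ i, z.1 i ≤ u i) → IsNNComb G z)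
    (hS : ∀ v ∈ G, ∀ w ∈ G, v.2 * w.2 < 0 → (∀ i, v.1 i + w.1 i ≤ u i) →
      IsNNCombP G (fun a => sqle a (v + w)) (v + w)) :
    ∀ z : (Fin j → ℤ) × ℤ,
      (IsIrred (KPairPlus n s j hjn p) z ∨ IsIrred (KPairMinus n s j hjn p) z) →
      (∀ i, z.1 i ≤ u i) → z ∈ G := by
  intro z hz hzu
  have hG : ∀ a ∈ G, a ∈ KPair n s j hjn p ∧ ∀ i, 0 ≤ a.1 i := fun a ha =>
    (hGsub ha).elim (fun h => ⟨h.1, h.2.1⟩) fun h => ⟨h.1, h.2.1⟩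
  obtain ⟨m₀, hm₀, rfl⟩ := (hGgen z (hz.imp (·.1) (·.1)) hzu).exists_multiset
  obtain ⟨m, hm, hsum, hsign⟩ := exists_same_sign_sum (fun a ha => (hG a ha).2) hS m₀ hm₀ hzu
  rw [← hsum] at hz ⊢
  obtain ⟨hpos, hneg⟩ := snd_sign_of_sum_snd_sign hsign
  rcases hz with hz | hz
  · exact hm _ (IsIrred.mem_of_eq_multiset_sum (KPairPlusSubmonoid n s j hjn p) hz m
      (fun a ha => ⟨(hG a (hm a ha)).1, (hG a (hm a ha)).2, hpos hz.1.2.2 a ha⟩) rfl)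
  · exact hm _ (IsIrred.mem_of_eq_multiset_sum (KPairMinusSubmonoid n s j hjn p) hz m
      (fun a ha => ⟨(hG a (hm a ha)).1, (hG a (hm a ha)).2, hneg hz.1.2.2 a ha⟩) rfl)
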